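/- Let h : ℝ^d → ℝ be differentiable with L-Lipschitz gradient and bounded below by h* ∈ ℝ. Let N ≥ 1, set η = 1/√N and m = √N, and on a probability space let θ_1 ∈ ℝ^d be deterministic and let random vectors θ_2, …, θ_{N+1} and Ĝ_1, …, Ĝ_N in ℝ^d satisfy θ_{k+1} = θ_k − η·Ĝ_k almost surely for k = 1, …, N. Suppose there are constants κ > 0 and C̃ > 0 such that for every k, E[‖∇h(θ_k) − Ĝ_k‖²] ≤ κ/m and E[‖Ĝ_k‖²] ≤ C̃. Then (1/N)·Σ_{k=1}^N E[‖∇h(θ_k)‖²] ≤ 2·(h(θ_1) − h*)/√N + (κ + L·C̃)/√N. -/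

import Mathlib

open MeasureTheory

/-- The descent lemma: a function with `L`-Lipschitz gradient lies below its quadratic model. -/
theorem le_add_inner_add_sq_of_lipschitz_gradient {E : Type*} [NormedAddCommGroup E]
    [InnerProductSpace ℝ E] [CompleteSpace E] {f : E → ℝ} {g : E → E}
    (hf : ∀ x, HasGradientAt f (g x) x) {L : ℝ}
    (hg : ∀ x y, ‖g x - g y‖ ≤ L * ‖x - y‖) (x v : E) :
    f (x + v) ≤ f x + inner ℝ (g x) v + L / 2 * ‖v‖ ^ 2 := by
  have hderiv : ∀ t : ℝ, HasDerivAt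
      (fun t : ℝ => f (x + t • v) - t * inner ℝ (g x) v - L / 2 * ‖v‖ ^ 2 * t ^ 2)
      (inner ℝ (g (x + t • v)) v - inner ℝ (g x) v - L * ‖v‖ ^ 2 * t) t := by
    intro t
    have hline : HasDerivAt (fun t : ℝ => x + t • v) v t := by
      simpa using ((hasDerivAt_id t).smul_const v).const_add x
    have hcomp := (hf (x + t • v)).hasFDerivAt.comp_hasDerivAt t hline
    simp only [InnerProductSpace.toDual_apply_apply] at hcomp
    refine ((hcomp.sub ((hasDerivAt_id t).mul_const (inner ℝ (g x) v))).sub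
      ((hasDerivAt_pow 2 t).const_mul (L / 2 * ‖v‖ ^ 2))).congr_deriv ?_
    push_cast
    ring
  have hanti : AntitoneOn
      (fun t : ℝ => f (x + t • v) - t * inner ℝ (g x) v - L / 2 * ‖v‖ ^ 2 * t ^ 2)
      (Set.Ici 0) := by
    refine antitoneOn_of_deriv_nonpos (convex_Ici 0)
      (fun t _ => (hderiv t).continuousAt.continuousWithinAt)
      (fun t _ => (hderiv t).differentiableAt.differentiableWithinAt) fun t ht => ?_
    rw [interior_Ici, Set.mem_Ioi] at ht
    rw [(hderiv t).deriv, ← inner_sub_left]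
    have hlip := hg (x + t • v) x
    rw [add_sub_cancel_left, norm_smul, Real.norm_of_nonneg ht.le] at hlip
    nlinarith [real_inner_le_norm (g (x + t • v) - g x) v,
      mul_le_mul_of_nonneg_right hlip (norm_nonneg v)]
  have hle := hanti (Set.mem_Ici.2 le_rfl) (Set.mem_Ici.2 zero_le_one) zero_le_one
  simp only [one_smul, zero_smul, add_zero] at hle
  linarith

/-- One step of an inexact gradient iteration with step size `η`. -/
theorem eta_mul_norm_sq_gradient_le {E : Type*} [NormedAddCommGroup E]
    [InnerProductSpace ℝ E] [CompleteSpace E] {f : E → ℝ} {g : E → E}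
    (hf : ∀ x, HasGradientAt f (g x) x) {L : ℝ}
    (hg : ∀ x y, ‖g x - g y‖ ≤ L * ‖x - y‖) {η : ℝ} (hη : 0 ≤ η) (x v : E) :
    η * ‖g x‖ ^ 2 ≤
      2 * (f x - f (x - η • v)) + η * ‖g x - v‖ ^ 2 + L * η ^ 2 * ‖v‖ ^ 2 := by
  have hdesc := le_add_inner_add_sq_of_lipschitz_gradient hf hg x (-(η • v))
  rw [← sub_eq_add_neg, inner_neg_right, inner_smul_right, norm_neg, norm_smul,
    Real.norm_of_nonneg hη] at hdesc
  rw [norm_sub_sq_real]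
  nlinarith [mul_nonneg hη (sq_nonneg ‖v‖)]

/-- non-asymptotic bound for the stochastic gradient iteration with step
size `η = 1/√N` and batch size `m = √N`: under the estimation-error bound
`E[‖∇h(θ_k) − Ĝ_k‖²] ≤ κ/√N` and the second-moment bound `E[‖Ĝ_k‖²] ≤ C̃`,
`(1/N)·Σ_{k=1}^N E[‖∇h(θ_k)‖²] ≤ 2(h(θ_1) − h*)/√N + (κ + LC̃)/√N`. -/
theorem rapg_nonasymptotic_bound_sqrtN
    {d : ℕ} (h : EuclideanSpace ℝ (Fin d) → ℝ)
    (Gh : EuclideanSpace ℝ (Fin d) → EuclideanSpace ℝ (Fin d))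
    (hdiff : ∀ x, HasGradientAt h (Gh x) x)
    (L : ℝ) (hL : 0 < L) (hLip : ∀ x y, ‖Gh x - Gh y‖ ≤ L * ‖x - y‖)
    (hstar : ℝ) (hbelow : ∀ x, hstar ≤ h x)
    {Ω : Type*} [MeasurableSpace Ω] (μ : Measure Ω) [IsProbabilityMeasure μ]
    (N : ℕ) (hN : 1 ≤ N)
    (θ : ℕ → Ω → EuclideanSpace ℝ (Fin d))
    (Ghat : ℕ → Ω → EuclideanSpace ℝ (Fin d))
    (θ1 : EuclideanSpace ℝ (Fin d)) (hθ1 : θ 0 = fun _ => θ1)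
    (hmeas : ∀ k, AEStronglyMeasurable (Ghat k) μ)
    (hupd : ∀ k < N, ∀ᵐ ω ∂μ,
      θ (k + 1) ω = θ k ω - (1 / Real.sqrt N) • Ghat k ω)
    (κ Ctil : ℝ) (hκ : 0 < κ) (hCtil : 0 < Ctil)
    (hvar : ∀ k < N,
      ∫⁻ ω, ENNReal.ofReal (‖Gh (θ k ω) - Ghat k ω‖ ^ 2) ∂μ
        ≤ ENNReal.ofReal (κ / Real.sqrt N))
    (hsec : ∀ k < N,
      ∫⁻ ω, ENNReal.ofReal (‖Ghat k ω‖ ^ 2) ∂μ ≤ ENNReal.ofReal Ctil) :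
    (N : ENNReal)⁻¹ * ∑ k ∈ Finset.range N, ∫⁻ ω, ENNReal.ofReal (‖Gh (θ k ω)‖ ^ 2) ∂μ
      ≤ ENNReal.ofReal
          (2 * (h θ1 - hstar) / Real.sqrt N + (κ + L * Ctil) / Real.sqrt N) := by
  set s : ℝ := Real.sqrt N
  have hNpos : (0 : ℝ) < N := by exact_mod_cast hN
  have hspos : 0 < s := Real.sqrt_pos.2 hNpos
  have hsq : s * s = N := Real.mul_self_sqrt hNpos.le
  have hGcont : Continuous Gh :=
    (LipschitzWith.of_dist_le_mul (K := ⟨L, hL.le⟩) fun x y => by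
      rw [dist_eq_norm, dist_eq_norm]
      exact hLip x y).continuous
  have hθmeas : ∀ k ≤ N, AEStronglyMeasurable (θ k) μ := by
    intro k
    induction k with
    | zero => intro _; rw [hθ1]; exact aestronglyMeasurable_const
    | succ k ih =>
      intro hk
      exact ((ih (by lia)).sub ((hmeas k).const_smul (1 / s))).congr
        ((hupd k (by lia)).mono fun ω hω => hω.symm)
  have hAmeas : ∀ k ∈ Finset.range N,
      AEMeasurable (fun ω => ENNReal.ofReal (‖Gh (θ k ω)‖ ^ 2)) μ := fun k hk =>
    ((hGcont.comp_aestronglyMeasurable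
      (hθmeas k (Finset.mem_range.1 hk).le)).norm.aemeasurable.pow_const 2).ennreal_ofReal
  have hBmeas : ∀ k ∈ Finset.range N,
      AEMeasurable (fun ω => ENNReal.ofReal (‖Gh (θ k ω) - Ghat k ω‖ ^ 2)) μ := fun k hk =>
    (((hGcont.comp_aestronglyMeasurable
      (hθmeas k (Finset.mem_range.1 hk).le)).sub
        (hmeas k)).norm.aemeasurable.pow_const 2).ennreal_ofReal
  have hCmeas : ∀ k ∈ Finset.range N,
      AEMeasurable (fun ω => ENNReal.ofReal (‖Ghat k ω‖ ^ 2)) μ := fun k _ =>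
    ((hmeas k).norm.aemeasurable.pow_const 2).ennreal_ofReal
  have hgap : 0 ≤ h θ1 - hstar := sub_nonneg.2 (hbelow θ1)
  have hpath : ∀ᵐ ω ∂μ, ∑ k ∈ Finset.range N, ENNReal.ofReal (‖Gh (θ k ω)‖ ^ 2) ≤
      ENNReal.ofReal (2 * s * (h θ1 - hstar)) +
        (∑ k ∈ Finset.range N, ENNReal.ofReal (‖Gh (θ k ω) - Ghat k ω‖ ^ 2) +
          ENNReal.ofReal (L / s) * ∑ k ∈ Finset.range N, ENNReal.ofReal (‖Ghat k ω‖ ^ 2)) := by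
    filter_upwards [(Finset.range N).eventually_all.2
      fun k hk => hupd k (Finset.mem_range.1 hk)] with ω hω
    have hstep : ∀ k ∈ Finset.range N, ‖Gh (θ k ω)‖ ^ 2 ≤
        2 * s * (h (θ k ω) - h (θ (k + 1) ω)) +
          (‖Gh (θ k ω) - Ghat k ω‖ ^ 2 + L / s * ‖Ghat k ω‖ ^ 2) := by
      intro k hk
      have hone := mul_le_mul_of_nonneg_left (eta_mul_norm_sq_gradient_le hdiff hLip
        (one_div_pos.2 hspos).le (θ k ω) (Ghat k ω)) hspos.le
      rw [← hω k hk] at hone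
      calc ‖Gh (θ k ω)‖ ^ 2 = s * (1 / s * ‖Gh (θ k ω)‖ ^ 2) := by field_simp
        _ ≤ _ := hone
        _ = _ := by field_simp; ring
    have hsum := Finset.sum_le_sum hstep
    rw [Finset.sum_add_distrib, Finset.sum_add_distrib, ← Finset.mul_sum, ← Finset.mul_sum,
      Finset.sum_range_sub' (fun k => h (θ k ω)), hθ1] at hsum
    rw [← ENNReal.ofReal_sum_of_nonneg fun _ _ => sq_nonneg _,
      ← ENNReal.ofReal_sum_of_nonneg fun _ _ => sq_nonneg _,
      ← ENNReal.ofReal_sum_of_nonneg fun _ _ => sq_nonneg _,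
      ← ENNReal.ofReal_mul (by positivity), ← ENNReal.ofReal_add (by positivity) (by positivity),
      ← ENNReal.ofReal_add (by positivity) (by positivity)]
    refine ENNReal.ofReal_le_ofReal (hsum.trans ?_)
    gcongr
    exact hbelow _
  have htotal : ∑ k ∈ Finset.range N, ∫⁻ ω, ENNReal.ofReal (‖Gh (θ k ω)‖ ^ 2) ∂μ ≤
      ENNReal.ofReal (2 * s * (h θ1 - hstar) + (N * (κ / s) + L / s * (N * Ctil))) := by
    rw [← lintegral_finsetSum' _ hAmeas]
    refine (lintegral_mono_ae hpath).trans ?_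
    rw [lintegral_add_left measurable_const,
      lintegral_add_left' (Finset.aemeasurable_fun_sum _ hBmeas),
      lintegral_const_mul' _ _ ENNReal.ofReal_ne_top, lintegral_finsetSum' _ hBmeas,
      lintegral_finsetSum' _ hCmeas, ENNReal.ofReal_add (by positivity) (by positivity),
      ENNReal.ofReal_add (by positivity) (by positivity), ENNReal.ofReal_mul (p := L / s)
      (by positivity), ENNReal.ofReal_mul (p := (N : ℝ)) (by positivity),
      ENNReal.ofReal_mul (p := (N : ℝ)) (by positivity), ENNReal.ofReal_natCast]
    gcongr
    · simp
    · simpa using Finset.sum_le_card_nsmul _ _ _ fun k hk => hvar k (Finset.mem_range.1 hk)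
    · simpa using Finset.sum_le_card_nsmul _ _ _ fun k hk => hsec k (Finset.mem_range.1 hk)
  calc _ ≤ (N : ENNReal)⁻¹ *
        ENNReal.ofReal (2 * s * (h θ1 - hstar) + (N * (κ / s) + L / s * (N * Ctil))) := by
        gcongr
    _ = _ := by
      rw [← ENNReal.ofReal_natCast, ← ENNReal.ofReal_inv_of_pos hNpos,
        ← ENNReal.ofReal_mul (by positivity), ← hsq]
      congr 1
      field_simp
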